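/- arXiv:2402.06618 — 2 statements merged into one kernel-verified Lean document; each statement's English description precedes it below -/
import Mathlib

section
/- For every n ≥ 1 (and also for n = 0), κ_n = (−1)^n Q_n(1), where Q_n(x) := ∫₀ˣ q_n'(t) q_{n-1}(t) dt and κ_n := ∫₀¹ h_n. -/
open Set MeasureTheory Polynomial

noncomputable section

/-- The class `E` of antitone functions `g : [0,1] → [0,1]` with `g 0 = 1` and
positive integral (functions are modelled as total functions `ℝ → ℝ`,
constrained on `[0,1]`). -/
def E : Set (ℝ → ℝ) :=
  {g | AntitoneOn g (Icc 0 1) ∧ MapsTo g (Icc 0 1) (Icc 0 1) ∧ g 0 = 1 ∧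
    0 < ∫ x in (0:ℝ)..1, g x}

/-- The pseudo-inverse `g*` of `g`, given by `g* y = sup {x ∈ [0,1] | g x ≥ y}`. -/
def pseudoInv (g : ℝ → ℝ) : ℝ → ℝ := fun y => sSup {x | x ∈ Icc (0:ℝ) 1 ∧ y ≤ g x}

/-- The stribolic operator `T`, `(T g) x = (∫_x^1 g*) / (∫_0^1 g)`. -/
def T (g : ℝ → ℝ) : ℝ → ℝ := fun x =>
  (∫ t in x..(1:ℝ), pseudoInv g t) / (∫ t in (0:ℝ)..1, g t)

/-- The canonical stribolic iterates: `h 0 = 1` and `h (n+1) = T (h n)`. -/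
def h : ℕ → ℝ → ℝ
  | 0 => fun _ => 1
  | n + 1 => T (h n)

/-- `κ n = ∫_0^1 h n`. -/
def κ (n : ℕ) : ℝ := ∫ t in (0:ℝ)..1, h n t

/-- The compositions `q n = h n ∘ ⋯ ∘ h 1`, with `q 0 = id`. -/
def q : ℕ → ℝ → ℝ
  | 0 => fun x => x
  | n + 1 => h (n + 1) ∘ q n

/-- `q (n-1)`, with the convention that for `n = 0` (i.e. "`q (-1)`") it is the
constant function `1` (the only convention making the `n = 0` cases hold). -/
def qprev : ℕ → ℝ → ℝ
  | 0 => fun _ => 1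
  | n + 1 => q n

/-- `Q n x = ∫_0^x (q n)' (t) * q (n-1) (t) dt`. -/
def Q (n : ℕ) (x : ℝ) : ℝ := ∫ t in (0:ℝ)..x, deriv (q n) t * qprev n t

/-- `f` is continuous on `[0,1]`, maps `[0,1]` and `(0,1)` to themselves, and is differentiable on
`(0,1)` with derivative `f'`, which is continuous on `[0,1]`. -/
structure IsC1SelfMap (f f' : ℝ → ℝ) : Prop where
  continuousOn : ContinuousOn f (Icc 0 1)
  continuousOn_deriv : ContinuousOn f' (Icc 0 1)
  hasDerivAt : ∀ x ∈ Ioo (0:ℝ) 1, HasDerivAt f (f' x) x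
  mapsTo_Icc : MapsTo f (Icc 0 1) (Icc 0 1)
  mapsTo_Ioo : MapsTo f (Ioo 0 1) (Ioo 0 1)

/-- `g` is a decreasing bijection of `[0,1]` which is differentiable on `(0,1)` with negative
derivative `g'` that is continuous on `[0,1]`. -/
structure IsC1Decreasing (g g' : ℝ → ℝ) : Prop where
  continuousOn : ContinuousOn g (Icc 0 1)
  continuousOn_deriv : ContinuousOn g' (Icc 0 1)
  hasDerivAt : ∀ x ∈ Ioo (0:ℝ) 1, HasDerivAt g (g' x) x
  deriv_neg : ∀ x ∈ Ioo (0:ℝ) 1, g' x < 0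
  map_zero : g 0 = 1
  map_one : g 1 = 0

lemma IsC1SelfMap.comp {f f' g g' : ℝ → ℝ} (hf : IsC1SelfMap f f') (hg : IsC1SelfMap g g') :
    IsC1SelfMap (f ∘ g) (fun x => f' (g x) * g' x) where
  continuousOn := hf.continuousOn.comp hg.continuousOn hg.mapsTo_Icc
  continuousOn_deriv :=
    (hf.continuousOn_deriv.comp hg.continuousOn hg.mapsTo_Icc).mul hg.continuousOn_deriv
  hasDerivAt x hx := (hf.hasDerivAt _ (hg.mapsTo_Ioo hx)).comp x (hg.hasDerivAt x hx)
  mapsTo_Icc := hf.mapsTo_Icc.comp hg.mapsTo_Icc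
  mapsTo_Ioo := hf.mapsTo_Ioo.comp hg.mapsTo_Ioo

lemma IsC1SelfMap.integral_comp_mul_deriv {f f' F : ℝ → ℝ} (hf : IsC1SelfMap f f')
    (hF : ContinuousOn F (Icc 0 1)) :
    ∫ x in (0:ℝ)..1, F (f x) * f' x = ∫ u in f 0..f 1, F u := by
  refine intervalIntegral.integral_comp_mul_deriv'' (g := F) ?_ (fun x hx => ?_) ?_ ?_
  · simpa using hf.continuousOn
  · exact (hf.hasDerivAt x (by simpa using hx)).hasDerivWithinAt
  · simpa using hf.continuousOn_deriv
  · exact hF.mono (by simpa using hf.mapsTo_Icc.image_subset)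

namespace IsC1Decreasing

variable {g g' : ℝ → ℝ}

lemma strictAntiOn (hg : IsC1Decreasing g g') : StrictAntiOn g (Icc 0 1) := by
  refine strictAntiOn_of_deriv_neg (convex_Icc 0 1) hg.continuousOn fun x hx => ?_
  rw [interior_Icc] at hx
  rw [(hg.hasDerivAt x hx).deriv]
  exact hg.deriv_neg x hx

lemma isC1SelfMap (hg : IsC1Decreasing g g') : IsC1SelfMap g g' where
  continuousOn := hg.continuousOn
  continuousOn_deriv := hg.continuousOn_deriv
  hasDerivAt := hg.hasDerivAt
  mapsTo_Icc x hx := by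
    have h0 := hg.strictAntiOn.antitoneOn (left_mem_Icc.2 zero_le_one) hx hx.1
    have h1 := hg.strictAntiOn.antitoneOn hx (right_mem_Icc.2 zero_le_one) hx.2
    rw [hg.map_zero] at h0
    rw [hg.map_one] at h1
    exact ⟨h1, h0⟩
  mapsTo_Ioo x hx := by
    have hx' := Ioo_subset_Icc_self hx
    have h0 := hg.strictAntiOn (left_mem_Icc.2 zero_le_one) hx' hx.1
    have h1 := hg.strictAntiOn hx' (right_mem_Icc.2 zero_le_one) hx.2
    rw [hg.map_zero] at h0
    rw [hg.map_one] at h1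
    exact ⟨h1, h0⟩

lemma surjOn (hg : IsC1Decreasing g g') : SurjOn g (Icc 0 1) (Icc 0 1) := by
  have := intermediate_value_Icc' zero_le_one hg.continuousOn
  rwa [hg.map_zero, hg.map_one] at this

lemma pseudoInv_apply (hg : IsC1Decreasing g g') {x : ℝ} (hx : x ∈ Icc (0:ℝ) 1) :
    pseudoInv g (g x) = x := by
  have : {z | z ∈ Icc (0:ℝ) 1 ∧ g x ≤ g z} = Icc 0 x := by
    ext z
    constructor
    · rintro ⟨hz, hzx⟩
      exact ⟨hz.1, (hg.strictAntiOn.le_iff_ge hx hz).1 hzx⟩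
    · intro hz
      have hz' : z ∈ Icc (0:ℝ) 1 := ⟨hz.1, hz.2.trans hx.2⟩
      exact ⟨hz', (hg.strictAntiOn.le_iff_ge hx hz').2 hz.2⟩
  rw [pseudoInv, this, csSup_Icc hx.1]

lemma continuousOn_pseudoInv (hg : IsC1Decreasing g g') : ContinuousOn (pseudoInv g) (Icc 0 1) := by
  refine continuousOn_iff_isClosed.2 fun t ht => ⟨g '' (Icc 0 1 ∩ t), ?_, ?_⟩
  · exact ((isCompact_Icc.inter_right ht).image_of_continuousOn
      (hg.continuousOn.mono inter_subset_left)).isClosed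
  · ext y
    constructor
    · rintro ⟨hyt, hy⟩
      obtain ⟨x, hx, rfl⟩ := hg.surjOn hy
      rw [mem_preimage, hg.pseudoInv_apply hx] at hyt
      exact ⟨⟨x, ⟨hx, hyt⟩, rfl⟩, hy⟩
    · rintro ⟨⟨x, ⟨hx, hxt⟩, rfl⟩, hy⟩
      exact ⟨by rwa [mem_preimage, hg.pseudoInv_apply hx], hy⟩

lemma pseudoInv_pos (hg : IsC1Decreasing g g') {y : ℝ} (hy : y ∈ Ioo (0:ℝ) 1) :
    0 < pseudoInv g y := by
  obtain ⟨x, hx, rfl⟩ := hg.surjOn (Ioo_subset_Icc_self hy)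
  rw [hg.pseudoInv_apply hx]
  refine hx.1.lt_of_ne ?_
  rintro rfl
  exact hy.2.ne hg.map_zero

lemma integral_deriv_mul_id (hg : IsC1Decreasing g g') :
    ∫ x in (0:ℝ)..1, g' x * x = -∫ x in (0:ℝ)..1, g x := by
  have hparts := intervalIntegral.integral_mul_deriv_eq_deriv_mul_of_hasDerivAt
    (a := 0) (b := 1) (u := fun x => x) (u' := fun _ => 1) (v := g) (v' := g')
    continuousOn_id (by simpa using hg.continuousOn) (fun x _ => hasDerivAt_id x)
    (fun x hx => hg.hasDerivAt x (by simpa using hx)) (by simp)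
    (ContinuousOn.intervalIntegrable (by simpa using hg.continuousOn_deriv))
  simpa [hg.map_one, mul_comm] using hparts

lemma integral_pseudoInv (hg : IsC1Decreasing g g') :
    ∫ y in (0:ℝ)..1, pseudoInv g y = ∫ x in (0:ℝ)..1, g x := by
  have hsubst := hg.isC1SelfMap.integral_comp_mul_deriv hg.continuousOn_pseudoInv
  rw [hg.map_zero, hg.map_one, intervalIntegral.integral_symm 0 1] at hsubst
  have hid : ∫ x in (0:ℝ)..1, pseudoInv g (g x) * g' x = ∫ x in (0:ℝ)..1, g' x * x := by
    refine intervalIntegral.integral_congr fun x hx => ?_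
    rw [hg.pseudoInv_apply (by simpa using hx), mul_comm]
  rw [hid, hg.integral_deriv_mul_id] at hsubst
  exact (neg_injective hsubst).symm

lemma integral_pos (hg : IsC1Decreasing g g') : 0 < ∫ x in (0:ℝ)..1, g x :=
  intervalIntegral.intervalIntegral_pos_of_pos_on
    (ContinuousOn.intervalIntegrable (by simpa using hg.continuousOn))
    (fun _ hx => (hg.isC1SelfMap.mapsTo_Ioo hx).1) zero_lt_one

lemma stribolic (hg : IsC1Decreasing g g') :
    IsC1Decreasing (T g) (fun x => -pseudoInv g x / ∫ t in (0:ℝ)..1, g t) where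
  continuousOn := by
    have hint : IntegrableOn (pseudoInv g) (uIcc 0 1) := by
      simpa using hg.continuousOn_pseudoInv.integrableOn_Icc
    have hcont := intervalIntegral.continuousOn_primitive_interval_left hint
    rw [uIcc_of_le zero_le_one] at hcont
    exact hcont.div_const _
  continuousOn_deriv := hg.continuousOn_pseudoInv.neg.div_const _
  hasDerivAt x hx := by
    have hnhds : Icc (0:ℝ) 1 ∈ nhds x := Icc_mem_nhds hx.1 hx.2
    refine (intervalIntegral.integral_hasDerivAt_left ?_ ?_ ?_).div_const _
    · refine (hg.continuousOn_pseudoInv.mono ?_).intervalIntegrable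
      rw [uIcc_of_le hx.2.le]
      exact Icc_subset_Icc_left hx.1.le
    · exact ⟨Icc 0 1, hnhds,
        hg.continuousOn_pseudoInv.aestronglyMeasurable measurableSet_Icc⟩
    · exact hg.continuousOn_pseudoInv.continuousAt hnhds
  deriv_neg x hx := div_neg_of_neg_of_pos (neg_neg_of_pos (hg.pseudoInv_pos hx)) hg.integral_pos
  map_zero := by
    rw [T, hg.integral_pseudoInv, div_self hg.integral_pos.ne']
  map_one := by simp [T]

end IsC1Decreasing

lemma T_one_apply {x : ℝ} (hx : x ≤ 1) : T (fun _ => 1) x = 1 - x := by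
  have hinv : ∫ t in x..(1:ℝ), pseudoInv (fun _ => 1) t = ∫ _ in x..(1:ℝ), (1:ℝ) := by
    refine intervalIntegral.integral_congr fun t ht => ?_
    rw [uIcc_of_le hx] at ht
    have : {z | z ∈ Icc (0:ℝ) 1 ∧ t ≤ 1} = Icc 0 1 := by
      ext z
      exact and_iff_left ht.2
    simp only [pseudoInv]
    rw [this, csSup_Icc zero_le_one]
  simp [T, hinv]

lemma isC1Decreasing_h_one : IsC1Decreasing (h 1) (fun _ => -1) where
  continuousOn := (continuousOn_const.sub continuousOn_id).congr fun x hx => T_one_apply hx.2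
  continuousOn_deriv := continuousOn_const
  hasDerivAt x hx := by
    refine ((hasDerivAt_id x).const_sub 1).congr_of_eventuallyEq ?_
    filter_upwards [Iio_mem_nhds hx.2] with z hz
    exact T_one_apply (le_of_lt hz)
  deriv_neg _ _ := by norm_num
  map_zero := (T_one_apply zero_le_one).trans (sub_zero 1)
  map_one := (T_one_apply le_rfl).trans (sub_self 1)

lemma exists_isC1Decreasing_h (n : ℕ) : ∃ g', IsC1Decreasing (h (n + 1)) g' := by
  induction n with
  | zero => exact ⟨_, isC1Decreasing_h_one⟩
  | succ n ih =>
    obtain ⟨g', hg⟩ := ih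
    exact ⟨_, hg.stribolic⟩

lemma exists_isC1SelfMap_q (n : ℕ) : ∃ f', IsC1SelfMap (q n) f' := by
  induction n with
  | zero =>
    exact ⟨fun _ => 1, continuousOn_id, continuousOn_const, fun x _ => hasDerivAt_id x,
      mapsTo_id _, mapsTo_id _⟩
  | succ n ih =>
    obtain ⟨f', hf⟩ := ih
    obtain ⟨g', hg⟩ := exists_isC1Decreasing_h n
    exact ⟨_, hg.isC1SelfMap.comp hf⟩

lemma q_endpoints (n : ℕ) : (q n 0 = 0 ∧ q n 1 = 1 ∧ (-1 : ℝ) ^ n = 1) ∨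
    (q n 0 = 1 ∧ q n 1 = 0 ∧ (-1 : ℝ) ^ n = -1) := by
  induction n with
  | zero => simp [q]
  | succ n ih =>
    obtain ⟨g', hg⟩ := exists_isC1Decreasing_h n
    rcases ih with ⟨h0, h1, hs⟩ | ⟨h0, h1, hs⟩ <;>
      simp [q, h0, h1, hs, hg.map_zero, hg.map_one, pow_succ]

lemma integral_q_endpoints (n : ℕ) (F : ℝ → ℝ) :
    ∫ x in q n 0..q n 1, F x = (-1 : ℝ) ^ n * ∫ x in (0:ℝ)..1, F x := by
  rcases q_endpoints n with ⟨h0, h1, hs⟩ | ⟨h0, h1, hs⟩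
  · rw [h0, h1, hs, one_mul]
  · rw [h0, h1, hs, neg_one_mul, intervalIntegral.integral_symm]

/-- For every n ≥ 1 (and also for n = 0), κ n = (−1)^n * Q n 1. -/
theorem stmt1 : ∀ n : ℕ, κ n = (-1 : ℝ) ^ n * Q n 1 := by
  rintro (_ | n)
  · have hid : deriv (q 0) = fun _ => 1 := deriv_id'
    simp [κ, Q, h, qprev, hid]
  · obtain ⟨f', hf⟩ := exists_isC1SelfMap_q n
    obtain ⟨g', hg⟩ := exists_isC1Decreasing_h n
    have hQ : Q (n + 1) 1 = ∫ t in (0:ℝ)..1, (fun s => g' s * s) (q n t) * f' t := by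
      refine intervalIntegral.integral_congr_Ioo_of_le zero_le_one fun t ht => ?_
      have hderiv : deriv (q (n + 1)) t = g' (q n t) * f' t :=
        ((hg.isC1SelfMap.comp hf).hasDerivAt t ht).deriv
      simp only [hderiv, qprev]
      ring
    have hs : ((-1 : ℝ) ^ n) * (-1) ^ n = 1 := by rw [← mul_pow]; simp
    rw [hQ, hf.integral_comp_mul_deriv (F := fun s => g' s * s)
      (hg.continuousOn_deriv.mul continuousOn_id),
      integral_q_endpoints, hg.integral_deriv_mul_id, κ, pow_succ]
    linear_combination (-∫ x in (0:ℝ)..1, h (n + 1) x) * hs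
end
end

section
/- For every n ≥ 1 (and also for n = 0), q_{n+1}(x) = q_{n+1}(0) − (1/κ_n) Q_n(x) for all x ∈ [0,1], where Q_n(x) := ∫₀ˣ q_n'(t) q_{n-1}(t) dt and κ_n := ∫₀¹ h_n > 0. -/
open Set MeasureTheory Polynomial

noncomputable section

/-- Continuous strictly decreasing bijections of `[0,1]`, exchanging the endpoints. -/
structure IsDecreasingBij (g : ℝ → ℝ) : Prop where
  continuousOn : ContinuousOn g (Icc 0 1)
  strictAntiOn : StrictAntiOn g (Icc 0 1)
  map_zero : g 0 = 1
  map_one : g 1 = 0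

namespace IsDecreasingBij

variable {g : ℝ → ℝ}

lemma mapsTo_Icc (hg : IsDecreasingBij g) : MapsTo g (Icc 0 1) (Icc 0 1) := fun _ hx =>
  ⟨hg.map_one ▸ hg.strictAntiOn.antitoneOn hx (right_mem_Icc.2 zero_le_one) hx.2,
    hg.map_zero ▸ hg.strictAntiOn.antitoneOn (left_mem_Icc.2 zero_le_one) hx hx.1⟩

lemma mapsTo_Ioo (hg : IsDecreasingBij g) : MapsTo g (Ioo 0 1) (Ioo 0 1) := fun _ hx =>
  ⟨hg.map_one ▸ hg.strictAntiOn (Ioo_subset_Icc_self hx) (right_mem_Icc.2 zero_le_one) hx.2,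
    hg.map_zero ▸ hg.strictAntiOn (left_mem_Icc.2 zero_le_one) (Ioo_subset_Icc_self hx) hx.1⟩

lemma surjOn_Icc (hg : IsDecreasingBij g) : SurjOn g (Icc 0 1) (Icc 0 1) := by
  have := intermediate_value_Icc' zero_le_one hg.continuousOn
  rwa [hg.map_zero, hg.map_one] at this

lemma integral_pos (hg : IsDecreasingBij g) : 0 < ∫ t in (0:ℝ)..1, g t :=
  intervalIntegral.intervalIntegral_pos_of_pos_on
    (hg.continuousOn.intervalIntegrable_of_Icc zero_le_one)
    (fun _ hx => (hg.mapsTo_Ioo hx).1) zero_lt_one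

lemma setOf_le_eq (hg : IsDecreasingBij g) {x : ℝ} (hx : x ∈ Icc (0:ℝ) 1) :
    {x' | x' ∈ Icc (0:ℝ) 1 ∧ g x ≤ g x'} = Icc 0 x := by
  ext z
  constructor
  · rintro ⟨hz, hle⟩
    exact ⟨hz.1, (hg.strictAntiOn.le_iff_ge hx hz).1 hle⟩
  · intro hz
    have hz' : z ∈ Icc (0:ℝ) 1 := ⟨hz.1, hz.2.trans hx.2⟩
    exact ⟨hz', (hg.strictAntiOn.le_iff_ge hx hz').2 hz.2⟩

lemma pseudoInv_apply (hg : IsDecreasingBij g) {x : ℝ} (hx : x ∈ Icc (0:ℝ) 1) :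
    pseudoInv g (g x) = x := by
  rw [pseudoInv, hg.setOf_le_eq hx, csSup_Icc hx.1]

lemma antitoneOn_pseudoInv (hg : IsDecreasingBij g) : AntitoneOn (pseudoInv g) (Icc 0 1) := by
  intro a ha b hb hab
  obtain ⟨x, hx, rfl⟩ := hg.surjOn_Icc ha
  obtain ⟨y, hy, rfl⟩ := hg.surjOn_Icc hb
  rw [hg.pseudoInv_apply hx, hg.pseudoInv_apply hy]
  exact (hg.strictAntiOn.le_iff_ge hx hy).1 hab

lemma pseudoInv_mem_Ioo (hg : IsDecreasingBij g) {y : ℝ} (hy : y ∈ Ioo (0:ℝ) 1) :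
    pseudoInv g y ∈ Ioo (0:ℝ) 1 := by
  obtain ⟨x, hx, rfl⟩ := hg.surjOn_Icc (Ioo_subset_Icc_self hy)
  rw [hg.pseudoInv_apply hx]
  refine ⟨hx.1.lt_of_ne ?_, hx.2.lt_of_ne ?_⟩
  · rintro rfl
    exact hy.2.ne hg.map_zero
  · rintro rfl
    exact hy.1.ne' hg.map_one

lemma continuousAt_pseudoInv (hg : IsDecreasingBij g) {y : ℝ} (hy : y ∈ Ioo (0:ℝ) 1) :
    ContinuousAt (pseudoInv g) y := by
  have hy' := hg.pseudoInv_mem_Ioo hy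
  have hmono : MonotoneOn (fun t => -pseudoInv g t) (Icc 0 1) := hg.antitoneOn_pseudoInv.neg
  have hcont : ContinuousAt (fun t => -pseudoInv g t) y := by
    refine continuousAt_of_monotoneOn_of_image_mem_nhds hmono (Icc_mem_nhds hy.1 hy.2) ?_
    refine Filter.mem_of_superset
      (Icc_mem_nhds (a := (-1:ℝ)) (b := 0) (by linarith [hy'.2]) (by linarith [hy'.1])) ?_
    intro z hz
    have hz' : -z ∈ Icc (0:ℝ) 1 := ⟨by linarith [hz.2], by linarith [hz.1]⟩
    exact ⟨g (-z), hg.mapsTo_Icc hz', by simp [hg.pseudoInv_apply hz']⟩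
  simpa only [neg_neg] using hcont.fun_neg

lemma intervalIntegrable_pseudoInv (hg : IsDecreasingBij g) :
    IntervalIntegrable (pseudoInv g) volume 0 1 :=
  AntitoneOn.intervalIntegrable (by simpa using hg.antitoneOn_pseudoInv)

lemma integral_pseudoInv (hg : IsDecreasingBij g) :
    ∫ t in (0:ℝ)..1, pseudoInv g t = ∫ t in (0:ℝ)..1, g t := by
  have hint : IntegrableOn g (Ioc 0 1) volume :=
    (hg.continuousOn.integrableOn_Icc).mono_set Ioc_subset_Icc_self
  have hnonneg : 0 ≤ᵐ[volume.restrict (Ioc (0:ℝ) 1)] g :=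
    (ae_restrict_iff' measurableSet_Ioc).2
      (ae_of_all _ fun x hx => (hg.mapsTo_Icc (Ioc_subset_Icc_self hx)).1)
  rw [intervalIntegral.integral_of_le zero_le_one, intervalIntegral.integral_of_le zero_le_one,
    hint.integral_eq_integral_meas_le hnonneg]
  have hmeas (t : ℝ) : (volume.restrict (Ioc (0:ℝ) 1)).real {a | t ≤ g a} =
      volume.real ({a | t ≤ g a} ∩ Ioc (0:ℝ) 1) := by
    rw [measureReal_def, Measure.restrict_apply' measurableSet_Ioc, measureReal_def]
  simp only [hmeas]
  rw [setIntegral_eq_of_subset_of_forall_sdiff_eq_zero measurableSet_Ioi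
    (Ioc_subset_Ioi_self : Ioc (0:ℝ) 1 ⊆ Ioi 0)]
  · refine setIntegral_congr_fun measurableSet_Ioc fun t ht => ?_
    obtain ⟨x, hx, rfl⟩ := hg.surjOn_Icc (Ioc_subset_Icc_self ht)
    have hset : {a | g x ≤ g a} ∩ Ioc (0:ℝ) 1 = Ioc 0 x := by
      ext z
      have := Set.ext_iff.1 (hg.setOf_le_eq hx) z
      simp only [mem_ofPred_eq, mem_Icc, mem_inter_iff, mem_Ioc] at this ⊢
      have := hx.2
      grind
    simp only [hset, hg.pseudoInv_apply hx, Real.volume_real_Ioc_of_le hx.1, sub_zero]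
  · intro t ht
    have hset : {a | t ≤ g a} ∩ Ioc (0:ℝ) 1 = ∅ := by
      refine eq_empty_of_forall_notMem fun z hz => ht.2 ⟨ht.1, ?_⟩
      exact le_trans hz.1 (hg.mapsTo_Icc (Ioc_subset_Icc_self hz.2)).2
    simp [hset]

lemma hasDerivAt_T (hg : IsDecreasingBij g) {x : ℝ} (hx : x ∈ Ioo (0:ℝ) 1) :
    HasDerivAt (T g) (-pseudoInv g x / ∫ t in (0:ℝ)..1, g t) x := by
  refine HasDerivAt.div_const ?_ _
  refine intervalIntegral.integral_hasDerivAt_left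
    (hg.intervalIntegrable_pseudoInv.mono_set ?_) ?_ (hg.continuousAt_pseudoInv hx)
  · rw [uIcc_of_le hx.2.le, uIcc_of_le zero_le_one]
    exact Icc_subset_Icc_left hx.1.le
  · exact ContinuousAt.stronglyMeasurableAtFilter isOpen_Ioo
      (fun y hy => hg.continuousAt_pseudoInv hy) x hx

protected lemma T (hg : IsDecreasingBij g) : IsDecreasingBij (T g) := by
  have hcont : ContinuousOn (_root_.T g) (Icc 0 1) := by
    refine ContinuousOn.div_const ?_ _
    have := intervalIntegral.continuousOn_primitive_interval_left (μ := volume)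
      (f := pseudoInv g) (a := 0) (b := 1) (by
        rw [uIcc_of_le zero_le_one]
        exact (intervalIntegrable_iff_integrableOn_Icc_of_le zero_le_one).1
          hg.intervalIntegrable_pseudoInv)
    rwa [uIcc_of_le zero_le_one] at this
  refine ⟨hcont, strictAntiOn_of_deriv_neg (convex_Icc 0 1) hcont fun x hx => ?_, ?_, ?_⟩
  · rw [interior_Icc] at hx
    rw [(hg.hasDerivAt_T hx).deriv]
    exact div_neg_of_neg_of_pos (neg_neg_of_pos (hg.pseudoInv_mem_Ioo hx).1) hg.integral_pos
  · rw [_root_.T, hg.integral_pseudoInv, div_self hg.integral_pos.ne']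
  · simp [_root_.T]

end IsDecreasingBij

lemma pseudoInv_h_zero {y : ℝ} (hy : y ≤ 1) : pseudoInv (h 0) y = 1 := by
  have hset : {x : ℝ | x ∈ Icc (0:ℝ) 1 ∧ y ≤ h 0 x} = Icc 0 1 := by
    ext x
    simp [h, hy]
  rw [pseudoInv, hset, csSup_Icc zero_le_one]

lemma kappa_zero : κ 0 = 1 := by simp [κ, h]

lemma h_one_apply {x : ℝ} (hx : x ≤ 1) : h 1 x = 1 - x := by
  have hnum : ∫ t in x..(1:ℝ), pseudoInv (h 0) t = 1 - x := by
    rw [intervalIntegral.integral_congr (g := fun _ => (1:ℝ))]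
    · simp
    · intro t ht
      rw [uIcc_of_le hx] at ht
      exact pseudoInv_h_zero ht.2
  have hden : ∫ t in (0:ℝ)..1, h 0 t = 1 := kappa_zero
  change (∫ t in x..(1:ℝ), pseudoInv (h 0) t) / (∫ t in (0:ℝ)..1, h 0 t) = 1 - x
  rw [hnum, hden, div_one]

lemma isDecreasingBij_h_succ : ∀ n : ℕ, IsDecreasingBij (h (n + 1))
  | 0 => by
    have heq : EqOn (h 1) (fun x => 1 - x) (Icc 0 1) := fun x hx => h_one_apply hx.2
    refine ⟨ContinuousOn.congr (by fun_prop) heq, fun x hx y hy hxy => ?_, ?_, ?_⟩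
    · simp only [zero_add, heq hx, heq hy]
      linarith
    · simp [h_one_apply zero_le_one]
    · simp [h_one_apply le_rfl]
  | n + 1 => (isDecreasingBij_h_succ n).T

lemma kappa_pos : ∀ n : ℕ, 0 < κ n
  | 0 => by simp [kappa_zero]
  | n + 1 => (isDecreasingBij_h_succ n).integral_pos

lemma hasDerivAt_h_succ (n : ℕ) {x : ℝ} (hx : x ∈ Ioo (0:ℝ) 1) :
    HasDerivAt (h (n + 1)) (-pseudoInv (h n) x / κ n) x := by
  cases n with
  | zero =>
    rw [pseudoInv_h_zero hx.2.le, kappa_zero, div_one]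
    refine ((hasDerivAt_id x).const_sub 1).congr_of_eventuallyEq ?_
    filter_upwards [Iio_mem_nhds hx.2] with y hy
    exact h_one_apply (le_of_lt hy)
  | succ n => exact (isDecreasingBij_h_succ n).hasDerivAt_T hx

lemma mapsTo_q_Icc : ∀ n : ℕ, MapsTo (q n) (Icc 0 1) (Icc 0 1)
  | 0 => mapsTo_id _
  | n + 1 => (isDecreasingBij_h_succ n).mapsTo_Icc.comp (mapsTo_q_Icc n)

lemma mapsTo_q_Ioo : ∀ n : ℕ, MapsTo (q n) (Ioo 0 1) (Ioo 0 1)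
  | 0 => mapsTo_id _
  | n + 1 => (isDecreasingBij_h_succ n).mapsTo_Ioo.comp (mapsTo_q_Ioo n)

lemma continuousOn_q : ∀ n : ℕ, ContinuousOn (q n) (Icc 0 1)
  | 0 => continuousOn_id
  | n + 1 => (isDecreasingBij_h_succ n).continuousOn.comp (continuousOn_q n) (mapsTo_q_Icc n)

lemma continuousOn_qprev : ∀ n : ℕ, ContinuousOn (qprev n) (Icc 0 1)
  | 0 => continuousOn_const
  | n + 1 => continuousOn_q n

lemma pseudoInv_h_q (n : ℕ) {x : ℝ} (hx : x ∈ Icc (0:ℝ) 1) :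
    pseudoInv (h n) (q n x) = qprev n x := by
  cases n with
  | zero => exact pseudoInv_h_zero hx.2
  | succ n => exact (isDecreasingBij_h_succ n).pseudoInv_apply (mapsTo_q_Icc n hx)

lemma hasDerivAt_q_succ_of_differentiableAt (n : ℕ) {x : ℝ} (hx : x ∈ Ioo (0:ℝ) 1)
    (hd : DifferentiableAt ℝ (q n) x) :
    HasDerivAt (q (n + 1)) (-(1 / κ n) * (deriv (q n) x * qprev n x)) x := by
  refine ((hasDerivAt_h_succ n (mapsTo_q_Ioo n hx)).comp x hd.hasDerivAt).congr_deriv ?_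
  rw [pseudoInv_h_q n (Ioo_subset_Icc_self hx)]
  ring

lemma differentiableAt_q (n : ℕ) {x : ℝ} (hx : x ∈ Ioo (0:ℝ) 1) :
    DifferentiableAt ℝ (q n) x := by
  induction n with
  | zero => exact differentiableAt_id
  | succ n ih => exact (hasDerivAt_q_succ_of_differentiableAt n hx ih).differentiableAt

lemma hasDerivAt_q_succ (n : ℕ) {x : ℝ} (hx : x ∈ Ioo (0:ℝ) 1) :
    HasDerivAt (q (n + 1)) (-(1 / κ n) * (deriv (q n) x * qprev n x)) x :=
  hasDerivAt_q_succ_of_differentiableAt n hx (differentiableAt_q n hx)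

lemma intervalIntegrable_deriv_q_mul_qprev_of_deriv {n : ℕ}
    (hd : IntervalIntegrable (deriv (q n)) volume 0 1) :
    IntervalIntegrable (fun t => deriv (q n) t * qprev n t) volume 0 1 :=
  hd.mul_continuousOn (by simpa using continuousOn_qprev n)

lemma intervalIntegrable_deriv_q (n : ℕ) : IntervalIntegrable (deriv (q n)) volume 0 1 := by
  induction n with
  | zero =>
    have : deriv (q 0) = fun _ => 1 := funext fun x => deriv_id x
    simp [this]
  | succ n ih =>
    refine ((intervalIntegrable_deriv_q_mul_qprev_of_deriv ih).const_mul
      (-(1 / κ n))).congr_uIoo fun x hx => ?_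
    rw [uIoo_of_le zero_le_one] at hx
    exact (hasDerivAt_q_succ n hx).deriv.symm

/-- For every n ≥ 1 (and also for n = 0), κ n > 0 and
q (n+1) x = q (n+1) 0 − (1/κ n) * Q n x for all x ∈ [0,1]. -/
theorem stmt2 : ∀ n : ℕ, 0 < κ n ∧
    ∀ x ∈ Icc (0:ℝ) 1, q (n + 1) x = q (n + 1) 0 - (1 / κ n) * Q n x := by
  refine fun n => ⟨kappa_pos n, fun x hx => ?_⟩
  have hint := intervalIntegrable_deriv_q_mul_qprev_of_deriv (intervalIntegrable_deriv_q n)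
  have hftc := intervalIntegral.integral_eq_sub_of_hasDerivAt_of_le hx.1
    ((continuousOn_q (n + 1)).mono (Icc_subset_Icc_right hx.2))
    (fun t ht => hasDerivAt_q_succ n (Ioo_subset_Ioo_right hx.2 ht))
    ((hint.mono_set (by
      rw [uIcc_of_le hx.1, uIcc_of_le zero_le_one]
      exact Icc_subset_Icc_right hx.2)).const_mul _)
  rw [intervalIntegral.integral_const_mul] at hftc
  rw [Q]
  linarith
end
end
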